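/- The symmetric minimum ⊼ is commutative and associative on all of L ((a ⊼ b) ⊼ c = a ⊼ (b ⊼ c) for all a, b, c), and it satisfies −(a ⊼ b) = (−a) ⊼ b for all a, b ∈ L. -/

import Mathlib

/-- The symmetric maximum on a linear order `L` with negation `neg` and
distinguished element `zero`; `max x (neg x)` plays the role of `|x|`. -/
def symMax {L : Type*} [LinearOrder L] (neg : L → L) (zero : L) (a b : L) : L :=
  if b = neg a then zero
  else if max (max a (neg a)) (max b (neg b)) = neg a ∨
          max (max a (neg a)) (max b (neg b)) = neg b then
    neg (max (max a (neg a)) (max b (neg b)))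
  else max (max a (neg a)) (max b (neg b))

/-- The symmetric minimum on a linear order `L` with negation `neg` and
distinguished element `zero`. -/
def symMin {L : Type*} [LinearOrder L] (neg : L → L) (zero : L) (a b : L) : L :=
  if (a < zero ∧ zero < b) ∨ (b < zero ∧ zero < a) then
    neg (min (max a (neg a)) (max b (neg b)))
  else min (max a (neg a)) (max b (neg b))

/-- The splitting-rule evaluation `⟨⊻ s⟩₋⁺` of a finite multiset `s`:
the symmetric maximum of the max of the nonnegative terms (`zero` if none)
and the min of the negative terms (`zero` if none). -/
def splitEval {L : Type*} [LinearOrder L] (neg : L → L) (zero : L) (s : Multiset L) : L :=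
  symMax neg zero ((s.filter (fun x => zero ≤ x)).fold max zero)
    ((s.filter (fun x => x < zero)).fold min zero)

section SymMin

variable {L : Type*} [LinearOrder L] {neg : L → L} {zero : L}

theorem symMin_comm (a b : L) :
    symMin neg zero a b = symMin neg zero b a := by
  simp only [symMin, min_comm (max b (neg b)), or_comm (a := b < zero ∧ zero < a)]

theorem zero_le_neg_iff (hord : ∀ x y, x ≤ y ↔ neg y ≤ neg x) (hzero : neg zero = zero)
    (x : L) : zero ≤ neg x ↔ x ≤ zero := by
  rw [hord x zero, hzero]

theorem neg_le_zero_iff (hord : ∀ x y, x ≤ y ↔ neg y ≤ neg x) (hzero : neg zero = zero)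
    (x : L) : neg x ≤ zero ↔ zero ≤ x := by
  rw [hord zero x, hzero]

theorem zero_le_max_neg (hord : ∀ x y, x ≤ y ↔ neg y ≤ neg x) (hzero : neg zero = zero)
    (x : L) : zero ≤ max x (neg x) := by
  rcases le_total zero x with h | h
  · exact le_max_of_le_left h
  · exact le_max_of_le_right ((zero_le_neg_iff hord hzero x).2 h)

theorem symMin_zero_left (hord : ∀ x y, x ≤ y ↔ neg y ≤ neg x) (hzero : neg zero = zero)
    (b : L) : symMin neg zero zero b = zero := by
  simp [symMin, hzero, zero_le_max_neg hord hzero b]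

theorem symMin_of_nonneg (hord : ∀ x y, x ≤ y ↔ neg y ≤ neg x) (hzero : neg zero = zero)
    {a b : L} (ha : zero ≤ a) (hb : zero ≤ b) : symMin neg zero a b = min a b := by
  have ha' := ((neg_le_zero_iff hord hzero a).2 ha).trans ha
  have hb' := ((neg_le_zero_iff hord hzero b).2 hb).trans hb
  simp [symMin, ha.not_gt, hb.not_gt, max_eq_left ha', max_eq_left hb']

theorem symMin_neg_left (hinv : ∀ x, neg (neg x) = x)
    (hord : ∀ x y, x ≤ y ↔ neg y ≤ neg x) (hzero : neg zero = zero) (a b : L) :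
    symMin neg zero (neg a) b = neg (symMin neg zero a b) := by
  have h₁ : neg a < zero ↔ zero < a := by
    rw [← not_le, ← not_le, zero_le_neg_iff hord hzero]
  have h₂ : zero < neg a ↔ a < zero := by
    rw [← not_le, ← not_le, neg_le_zero_iff hord hzero]
  rcases eq_or_ne a zero with rfl | ha
  · rw [hzero, symMin_zero_left hord hzero, hzero]
  rcases eq_or_ne b zero with rfl | hb
  · rw [symMin_comm, symMin_comm a,
      symMin_zero_left hord hzero, symMin_zero_left hord hzero, hzero]
  simp only [symMin, h₁, h₂, hinv, max_comm (neg a) a]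
  rcases lt_or_gt_of_ne ha with ha | ha <;> rcases lt_or_gt_of_ne hb with hb | hb <;>
    simp [ha, hb, ha.not_gt, hb.not_gt, hinv]

theorem symMin_neg_right (hinv : ∀ x, neg (neg x) = x)
    (hord : ∀ x y, x ≤ y ↔ neg y ≤ neg x) (hzero : neg zero = zero) (a b : L) :
    symMin neg zero a (neg b) = neg (symMin neg zero a b) := by
  rw [symMin_comm, symMin_neg_left hinv hord hzero,
    symMin_comm]

theorem exists_nonneg_eq_or_eq_neg (hinv : ∀ x, neg (neg x) = x)
    (hord : ∀ x y, x ≤ y ↔ neg y ≤ neg x) (hzero : neg zero = zero) (x : L) :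
    ∃ p, zero ≤ p ∧ (x = p ∨ x = neg p) := by
  rcases le_total zero x with h | h
  · exact ⟨x, h, Or.inl rfl⟩
  · exact ⟨neg x, (zero_le_neg_iff hord hzero x).2 h, Or.inr (hinv x).symm⟩

theorem symMin_assoc (hinv : ∀ x, neg (neg x) = x)
    (hord : ∀ x y, x ≤ y ↔ neg y ≤ neg x) (hzero : neg zero = zero) (a b c : L) :
    symMin neg zero (symMin neg zero a b) c = symMin neg zero a (symMin neg zero b c) := by
  obtain ⟨p, hp, ha⟩ := exists_nonneg_eq_or_eq_neg hinv hord hzero a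
  obtain ⟨q, hq, hb⟩ := exists_nonneg_eq_or_eq_neg hinv hord hzero b
  obtain ⟨r, hr, hc⟩ := exists_nonneg_eq_or_eq_neg hinv hord hzero c
  have key : symMin neg zero (symMin neg zero p q) r =
      symMin neg zero p (symMin neg zero q r) := by
    rw [symMin_of_nonneg hord hzero hp hq, symMin_of_nonneg hord hzero hq hr,
      symMin_of_nonneg hord hzero (le_min hp hq) hr,
      symMin_of_nonneg hord hzero hp (le_min hq hr), min_assoc]
  rcases ha with rfl | rfl <;> rcases hb with rfl | rfl <;> rcases hc with rfl | rfl <;>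
    simp only [symMin_neg_left hinv hord hzero, symMin_neg_right hinv hord hzero, key]

end SymMin

/-- the symmetric minimum is commutative and associative on all
of `L`, and `neg` can be pulled out of one argument. -/
theorem symMin_comm_assoc_neg {L : Type*} [LinearOrder L]
    (neg : L → L) (zero : L)
    (hinv : ∀ x, neg (neg x) = x)
    (hord : ∀ x y, x ≤ y ↔ neg y ≤ neg x)
    (hzero : neg zero = zero) :
    (∀ a b, symMin neg zero a b = symMin neg zero b a) ∧
    (∀ a b c, symMin neg zero (symMin neg zero a b) c =
      symMin neg zero a (symMin neg zero b c)) ∧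
    (∀ a b, neg (symMin neg zero a b) = symMin neg zero (neg a) b) :=
  ⟨symMin_comm, symMin_assoc hinv hord hzero,
    fun a b => (symMin_neg_left hinv hord hzero a b).symm⟩
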